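/- Let H be a type with three distinct elements π, σ, τ (e.g. H = Fin 3). Define the probability measures μ₁ = ½δ_{{π}} + ½δ_{{σ}}, μ₂ = ½δ_{{σ}} + ½δ_{{τ}}, ν₁ = ½δ_{{τ}} + ½δ_{{π,σ}}, ν₂ = ½δ_{{π}} + ½δ_{{σ,τ}} on (Set H, 𝔅), where δ_a denotes the Dirac measure at the set a. Then there is no probability measure ρ on (Set H, 𝔅) with μ₁ ⊑ ρ, μ₂ ⊑ ρ, ρ ⊑ ν₁, and ρ ⊑ ν₂; consequently μ₁ and μ₂ have no least upper bound with respect to ⊑, so the probability measures ordered by ⊑ do not form a semilattice. -/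

import Mathlib

open MeasureTheory Set ENNReal

/-- A set of subsets of `H` is Scott-open if it is an upper set for inclusion and
meets every directed family of subsets whose union it contains. -/
def ScottOpen {H : Type*} (U : Set (Set H)) : Prop :=
  (∀ ⦃a b : Set H⦄, a ⊆ b → a ∈ U → b ∈ U) ∧
  ∀ D : Set (Set H), D.Nonempty → DirectedOn (· ⊆ ·) D → ⋃₀ D ∈ U → (D ∩ U).Nonempty

/-- The Borel σ-algebra on `Set H` generated by the Scott-open sets. -/
def scottBorel (H : Type*) : MeasurableSpace (Set H) :=
  MeasurableSpace.generateFrom {U : Set (Set H) | ScottOpen U}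

/-- The order `μ ⊑ ν` on measures: `μ U ≤ ν U` for every Scott-open `U`. -/
def MeasLE {H : Type*} (μ ν : @Measure (Set H) (scottBorel H)) : Prop :=
  ∀ U : Set (Set H), ScottOpen U → μ U ≤ ν U

/-- The measure `½ δ_a + ½ δ_b` on `(Set H, 𝔅)`. -/
noncomputable def halfHalf {H : Type*} (a b : Set H) : @Measure (Set H) (scottBorel H) :=
  (2⁻¹ : ℝ≥0∞) • @Measure.dirac (Set H) (scottBorel H) a +
    (2⁻¹ : ℝ≥0∞) • @Measure.dirac (Set H) (scottBorel H) b

lemma ScottOpen.union {H : Type*} {U V : Set (Set H)} (hU : ScottOpen U) (hV : ScottOpen V) :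
    ScottOpen (U ∪ V) := by
  refine ⟨fun a b hab h ↦ h.imp (hU.1 hab) (hV.1 hab), fun D hne hD h ↦ ?_⟩
  rcases h with h | h
  · exact (hU.2 D hne hD h).mono (inter_subset_inter_right D subset_union_left)
  · exact (hV.2 D hne hD h).mono (inter_subset_inter_right D subset_union_right)

lemma ScottOpen.inter {H : Type*} {U V : Set (Set H)} (hU : ScottOpen U) (hV : ScottOpen V) :
    ScottOpen (U ∩ V) := by
  refine ⟨fun a b hab h ↦ h.imp (hU.1 hab) (hV.1 hab), fun D hne hD h ↦ ?_⟩
  obtain ⟨a, haD, haU⟩ := hU.2 D hne hD h.1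
  obtain ⟨b, hbD, hbV⟩ := hV.2 D hne hD h.2
  obtain ⟨c, hcD, hac, hbc⟩ := hD a haD b hbD
  exact ⟨c, hcD, hU.1 hac haU, hV.1 hbc hbV⟩

lemma scottOpen_setOf_mem {H : Type*} (x : H) : ScottOpen {c : Set H | x ∈ c} := by
  refine ⟨fun a b hab h ↦ hab h, fun D _ _ h ↦ ?_⟩
  obtain ⟨c, hcD, hxc⟩ := h
  exact ⟨c, hcD, hxc⟩

lemma ScottOpen.measurableSet {H : Type*} {U : Set (Set H)} (hU : ScottOpen U) :
    MeasurableSet[scottBorel H] U :=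
  MeasurableSpace.measurableSet_generateFrom hU

lemma halfHalf_apply {H : Type*} (a b : Set H) {U : Set (Set H)} (hU : ScottOpen U) :
    halfHalf a b U = 2⁻¹ * U.indicator 1 a + 2⁻¹ * U.indicator 1 b := by
  let := scottBorel H
  simp only [halfHalf, Measure.add_apply, Measure.smul_apply, smul_eq_mul,
    Measure.dirac_apply' _ hU.measurableSet]

lemma halfHalf_comm {H : Type*} (a b : Set H) : halfHalf a b = halfHalf b a := by
  let := scottBorel H
  exact add_comm _ _

lemma isProbabilityMeasure_halfHalf {H : Type*} (a b : Set H) :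
    @IsProbabilityMeasure (Set H) (scottBorel H) (halfHalf a b) := by
  let := scottBorel H
  constructor
  simp [halfHalf, ENNReal.inv_two_add_inv_two]

lemma halfHalf_mono {H : Type*} {a a' b b' : Set H} (ha : a ⊆ a') (hb : b ⊆ b') :
    MeasLE (halfHalf a b) (halfHalf a' b') := by
  have indicator_le {c c' : Set H} (h : c ⊆ c') {U : Set (Set H)} (hU : ScottOpen U) :
      U.indicator (1 : Set H → ℝ≥0∞) c ≤ U.indicator 1 c' := by
    by_cases hc : c ∈ U
    · simp [hc, hU.1 h hc]
    · simp [hc]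
  intro U hU
  rw [halfHalf_apply _ _ hU, halfHalf_apply _ _ hU]
  gcongr
  · exact indicator_le ha hU
  · exact indicator_le hb hU

/-- An upper bound of `½δ{π} + ½δ{σ}` and `½δ{σ} + ½δ{τ}` is concentrated on the sets that
contain `σ` or contain both `π` and `τ`. -/
lemma one_le_add_of_upperBound {H : Type*} {π σ τ : H}
    {ρ : @Measure (Set H) (scottBorel H)} (hρ : @IsProbabilityMeasure (Set H) (scottBorel H) ρ)
    (h₁ : MeasLE (halfHalf {π} {σ}) ρ) (h₂ : MeasLE (halfHalf {σ} {τ}) ρ) :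
    1 ≤ ρ {c | σ ∈ c} + ρ ({c | π ∈ c} ∩ {c | τ ∈ c}) := by
  let := scottBorel H
  have ae_mem (x y : H) (h : MeasLE (halfHalf {x} {y}) ρ) : ∀ᵐ c ∂ρ, x ∈ c ∨ y ∈ c := by
    have hU := (scottOpen_setOf_mem x).union (scottOpen_setOf_mem y)
    have h1 := h _ hU
    rw [halfHalf_apply _ _ hU] at h1
    simp only [mem_union, mem_ofPred_eq, mem_singleton_iff, true_or, or_true, indicator_of_mem,
      Pi.one_apply, mul_one, ENNReal.inv_two_add_inv_two] at h1
    exact (mem_ae_iff_prob_eq_one hU.measurableSet).2 (le_antisymm prob_le_one h1)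
  have h : ∀ᵐ c ∂ρ, c ∈ {c | σ ∈ c} ∪ ({c | π ∈ c} ∩ {c | τ ∈ c}) := by
    filter_upwards [ae_mem π σ h₁, ae_mem σ τ h₂] with c hc hc'
    simp only [mem_union, mem_inter_iff, mem_ofPred_eq]
    tauto
  calc 1 = ρ univ := measure_univ.symm
    _ ≤ ρ ({c | σ ∈ c} ∪ ({c | π ∈ c} ∩ {c | τ ∈ c})) :=
      measure_mono_ae (h.mono fun _ hc _ ↦ hc)
    _ ≤ _ := measure_union_le _ _

/-- No upper bound of `½δ{π} + ½δ{σ}` and `½δ{σ} + ½δ{τ}` is both below a measure giving mass at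
most `½` to the sets containing `σ` and below one giving mass `0` to those containing
`π` and `τ`. -/
lemma not_upperBound_of_le {H : Type*} {π σ τ : H}
    {ρ ν ν' : @Measure (Set H) (scottBorel H)}
    (hρ : @IsProbabilityMeasure (Set H) (scottBorel H) ρ)
    (h₁ : MeasLE (halfHalf {π} {σ}) ρ) (h₂ : MeasLE (halfHalf {σ} {τ}) ρ)
    (hν : MeasLE ρ ν) (hν' : MeasLE ρ ν') (hσ : ν {c | σ ∈ c} ≤ 2⁻¹)
    (hπτ : ν' ({c | π ∈ c} ∩ {c | τ ∈ c}) ≤ 0) : False := by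
  have h := (one_le_add_of_upperBound hρ h₁ h₂).trans
    (add_le_add ((hν _ (scottOpen_setOf_mem σ)).trans hσ)
      ((hν' _ ((scottOpen_setOf_mem π).inter (scottOpen_setOf_mem τ))).trans hπτ))
  rw [add_zero] at h
  exact absurd h (not_le.2 (ENNReal.inv_lt_one.2 ENNReal.one_lt_two))

/-- With `μ₁ = ½δ{π} + ½δ{σ}`, `μ₂ = ½δ{σ} + ½δ{τ}`, `ν₁ = ½δ{τ} + ½δ{π,σ}`,
`ν₂ = ½δ{π} + ½δ{σ,τ}`, there is no probability measure `ρ` with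
`μ₁ ⊑ ρ`, `μ₂ ⊑ ρ`, `ρ ⊑ ν₁`, `ρ ⊑ ν₂`; consequently `μ₁` and `μ₂` have no
`⊑`-least upper bound, so `(⊑)` is not a semilattice. -/
theorem not_semilattice {H : Type*} (π σ τ : H)
    (hπσ : π ≠ σ) (hπτ : π ≠ τ) (hστ : σ ≠ τ) :
    (¬ ∃ ρ : @Measure (Set H) (scottBorel H),
        @IsProbabilityMeasure (Set H) (scottBorel H) ρ ∧
        MeasLE (halfHalf {π} {σ}) ρ ∧ MeasLE (halfHalf {σ} {τ}) ρ ∧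
        MeasLE ρ (halfHalf {τ} {π, σ}) ∧ MeasLE ρ (halfHalf {π} {σ, τ})) ∧
    (¬ ∃ ρ : @Measure (Set H) (scottBorel H),
        @IsProbabilityMeasure (Set H) (scottBorel H) ρ ∧
        (MeasLE (halfHalf {π} {σ}) ρ ∧ MeasLE (halfHalf {σ} {τ}) ρ) ∧
        ∀ ρ' : @Measure (Set H) (scottBorel H),
          @IsProbabilityMeasure (Set H) (scottBorel H) ρ' →
          MeasLE (halfHalf {π} {σ}) ρ' → MeasLE (halfHalf {σ} {τ}) ρ' →
          MeasLE ρ ρ') := by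
  have hPT := (scottOpen_setOf_mem π).inter (scottOpen_setOf_mem τ)
  refine ⟨?_, ?_⟩
  · rintro ⟨ρ, hρ, h₁, h₂, h₃, -⟩
    refine not_upperBound_of_le hρ h₁ h₂ h₃ h₃ ?_ ?_
    · rw [halfHalf_apply _ _ (scottOpen_setOf_mem σ)]
      simp [hστ]
    · rw [halfHalf_apply _ _ hPT]
      simp [hπτ, hπτ.symm, hστ.symm]
  · rintro ⟨ρ, hρ, ⟨h₁, h₂⟩, hlub⟩
    have h₃ : MeasLE ρ (halfHalf {π, τ} {σ}) := by
      refine hlub _ (isProbabilityMeasure_halfHalf _ _) (halfHalf_mono (by simp) subset_rfl) ?_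
      rw [halfHalf_comm]
      exact halfHalf_mono (by simp) subset_rfl
    have h₄ : MeasLE ρ (halfHalf {π, σ} {σ, τ}) :=
      hlub _ (isProbabilityMeasure_halfHalf _ _) (halfHalf_mono (by simp) (by simp))
        (halfHalf_mono (by simp) (by simp))
    refine not_upperBound_of_le hρ h₁ h₂ h₃ h₄ ?_ ?_
    · rw [halfHalf_apply _ _ (scottOpen_setOf_mem σ)]
      simp [hστ, hπσ.symm]
    · rw [halfHalf_apply _ _ hPT]
      simp [hπσ, hπτ, hπτ.symm, hστ.symm]
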